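/- arXiv:1203.6665 — 3 statements merged into one kernel-verified Lean document; each statement's English description precedes it below -/
import Mathlib

section
/- For any subset A ⊆ Θ, any θ ∈ A, and any α ∈ (0,1), if the map y ↦ pl_y(A) is measurable, then P_θ({y : pl_y(A) ≤ α}) ≤ α; that is, under P_θ with θ ∈ A, the random variable pl_Y(A) is stochastically larger than a uniform random variable on (0,1). (Theorem 1.) -/
open MeasureTheory

/-- A finite measure on `ℝ` gives mass at most `c` to the set of points `t` with
`μ (Iic t) ≤ c`. -/
theorem measure_setOf_measure_Iic_le (μ : Measure ℝ) [IsFiniteMeasure μ] (c : ENNReal) :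
    μ {t | μ (Set.Iic t) ≤ c} ≤ c := by
  have hmono : Monotone fun t => μ (Set.Iic t) :=
    fun s t hst => measure_mono (Set.Iic_subset_Iic.2 hst)
  have hS : MeasurableSet {t | μ (Set.Iic t) ≤ c} := hmono.measurable measurableSet_Iic
  rw [hS.measure_eq_iSup_isCompact]
  refine iSup₂_le fun K hK => iSup_le fun hKc => ?_
  rcases K.eq_empty_or_nonempty with rfl | hne
  · simp
  · obtain ⟨m, hm, hmax⟩ := hKc.exists_isGreatest hne
    exact (measure_mono fun x hx => hmax hx).trans (hK hm)

/-- Theorem 1: for any `A ⊆ Θ`, any `θ ∈ A`, and any `α ∈ (0,1)`, the plausibility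
function `pl_Y(A)` is stochastically larger than uniform under `P_θ`. -/
theorem plausibility_function_validity
    {Y : Type*} [MeasurableSpace Y] {Θ : Type*}
    (P : Θ → Measure Y) (hP : ∀ θ, IsProbabilityMeasure (P θ))
    (T : Y → Θ → ℝ) (hT : ∀ θ, Measurable fun y => T y θ)
    (F : Θ → ℝ → ℝ) (hF : ∀ θ t, F θ t = (P θ {y | T y θ ≤ t}).toReal)
    (pl : Y → Set Θ → ℝ) (hpl : ∀ y A, pl y A = ⨆ θ ∈ A, F θ (T y θ))
    (A : Set Θ) (θ : Θ) (hθA : θ ∈ A)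
    (α : ℝ) (hα : α ∈ Set.Ioo (0 : ℝ) 1)
    (hmeas : Measurable fun y => pl y A) :
    P θ {y | pl y A ≤ α} ≤ ENNReal.ofReal α := by
  have hF_le (η : Θ) (t : ℝ) : F η t ≤ 1 := by
    rw [hF]
    exact measureReal_le_one
  have hF_le_pl (y : Y) : F θ (T y θ) ≤ pl y A := by
    have hbdd : BddAbove (Set.range fun η => ⨆ _ : η ∈ A, F η (T y η)) := by
      refine ⟨1, ?_⟩
      rintro _ ⟨η, rfl⟩
      exact Real.iSup_le (fun _ => hF_le η _) zero_le_one
    have h := le_ciSup hbdd θ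
    rw [hpl]
    simpa only [ciSup_pos hθA] using h
  have hmap (t : ℝ) : (P θ).map (fun y => T y θ) (Set.Iic t) = P θ {y | T y θ ≤ t} :=
    Measure.map_apply (hT θ) measurableSet_Iic
  calc P θ {y | pl y A ≤ α}
      ≤ P θ ((fun y => T y θ) ⁻¹'
          {t | (P θ).map (fun y => T y θ) (Set.Iic t) ≤ ENNReal.ofReal α}) := by
        refine measure_mono fun y hy => ?_
        have h := (hF_le_pl y).trans hy
        rw [hF] at h
        rw [Set.mem_preimage, Set.mem_ofPred_eq, hmap]
        exact (ENNReal.le_ofReal_iff_toReal_le (measure_ne_top _ _) hα.1.le).2 h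
    _ ≤ (P θ).map (fun y => T y θ)
          {t | (P θ).map (fun y => T y θ) (Set.Iic t) ≤ ENNReal.ofReal α} :=
        Measure.le_map_apply (hT θ).aemeasurable _
    _ ≤ ENNReal.ofReal α := measure_setOf_measure_Iic_le _ _
end

section
/- For any nonempty Θ₀ ⊆ Θ and any α ∈ (0,1), if the map y ↦ pl_y(Θ₀) is measurable, then sup_{θ∈Θ₀} P_θ({y : pl_y(Θ₀) ≤ α}) ≤ α; that is, the test that rejects H₀ : θ ∈ Θ₀ if and only if pl_y(Θ₀) ≤ α has size at most α. (Corollary 1, size bound.) -/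
open MeasureTheory

/-- The probability integral transform is stochastically no smaller than uniform, for an arbitrary
finite measure on `ℝ`. -/
theorem measure_setOf_measure_Iic_le_le (μ : Measure ℝ) [IsFiniteMeasure μ] (a : ENNReal) :
    μ {t | μ (Set.Iic t) ≤ a} ≤ a := by
  have hlower : IsLowerSet {t | μ (Set.Iic t) ≤ a} := fun s t hts hs =>
    (measure_mono (Set.Iic_subset_Iic.2 hts)).trans hs
  rw [hlower.ordConnected.measurableSet.measure_eq_iSup_isCompact]
  refine iSup₂_le fun K hKS => iSup_le fun hK => ?_
  rcases K.eq_empty_or_nonempty with rfl | hne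
  · simp
  · obtain ⟨m, hm, hmax⟩ := hK.exists_isGreatest hne
    exact (measure_mono hmax).trans (hKS hm)

/-- Corollary 1 (size bound): the test rejecting `H₀ : θ ∈ Θ₀` iff `pl_y(Θ₀) ≤ α`
has size at most `α`, i.e. `sup_{θ ∈ Θ₀} P_θ{y : pl_y(Θ₀) ≤ α} ≤ α`. -/
theorem plausibility_test_size
    {Y : Type*} [MeasurableSpace Y] {Θ : Type*}
    (P : Θ → Measure Y) (hP : ∀ θ, IsProbabilityMeasure (P θ))
    (T : Y → Θ → ℝ) (hT : ∀ θ, Measurable fun y => T y θ)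
    (F : Θ → ℝ → ℝ) (hF : ∀ θ t, F θ t = (P θ {y | T y θ ≤ t}).toReal)
    (pl : Y → Set Θ → ℝ) (hpl : ∀ y A, pl y A = ⨆ θ ∈ A, F θ (T y θ))
    (Θ₀ : Set Θ) (hΘ₀ : Θ₀.Nonempty)
    (α : ℝ) (hα : α ∈ Set.Ioo (0 : ℝ) 1)
    (hmeas : Measurable fun y => pl y Θ₀) :
    ⨆ θ ∈ Θ₀, P θ {y | pl y Θ₀ ≤ α} ≤ ENNReal.ofReal α := by
  refine iSup₂_le fun θ hθ => ?_
  have hF_le_one : ∀ θ t, F θ t ≤ 1 := fun θ t => by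
    have := hP θ
    rw [hF]
    exact measureReal_le_one
  have hF_le_pl : ∀ y, F θ (T y θ) ≤ pl y Θ₀ := fun y => by
    rw [hpl]
    have hbdd : BddAbove (Set.range fun θ => ⨆ _ : θ ∈ Θ₀, F θ (T y θ)) :=
      ⟨1, Set.forall_mem_range.2 fun θ => Real.iSup_le (fun _ => hF_le_one _ _) zero_le_one⟩
    refine le_trans (le_of_eq ?_) (le_ciSup hbdd θ)
    simp [hθ]
  have := hP θ
  have : IsProbabilityMeasure ((P θ).map fun y => T y θ) :=
    Measure.isProbabilityMeasure_map (hT θ).aemeasurable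
  have hsub : {y | pl y Θ₀ ≤ α} ⊆ (fun y => T y θ) ⁻¹'
      {t | (P θ).map (fun y => T y θ) (Set.Iic t) ≤ ENNReal.ofReal α} := fun y hy => by
    have h := (hF_le_pl y).trans hy
    rw [hF] at h
    rw [Set.mem_preimage, Set.mem_ofPred_eq, Measure.map_apply (hT θ) measurableSet_Iic]
    exact (ENNReal.le_ofReal_iff_toReal_le (measure_ne_top _ _) hα.1.le).2 h
  exact (measure_mono hsub).trans <| (Measure.le_map_apply (hT θ).aemeasurable _).trans <|
    measure_setOf_measure_Iic_le_le _ _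
end

section
/- Fix θ ∈ Θ and suppose the law of y ↦ T(y,θ) under P_θ has no atoms (equivalently, F_θ is a continuous function on ℝ). Then for every α ∈ (0,1), the plausibility region has exactly the nominal coverage probability: P_θ({y : θ ∈ Π_y(α)}) = 1 − α. (Corollary 2, exact coverage.) -/
open MeasureTheory

open ProbabilityTheory Filter Topology in
/-- The distribution function of an atomless probability measure on the line is continuous. -/
lemma continuous_cdf_of_nullSingletonClass (μ : Measure ℝ) [IsProbabilityMeasure μ]
    [NullSingletonClass μ] :
    Continuous (cdf μ) := by
  refine continuous_iff_continuousAt.2 fun a => ?_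
  have hle : Function.leftLim (cdf μ) a ≤ cdf μ a := (cdf μ).mono.leftLim_le le_rfl
  have h := (cdf μ).measure_singleton a
  rw [measure_cdf, measure_singleton, eq_comm, ENNReal.ofReal_eq_zero] at h
  rw [(cdf μ).mono.continuousAt_iff_leftLim_eq_rightLim, (cdf μ).rightLim_eq]
  linarith

open ProbabilityTheory Filter Topology in
/-- An atomless probability measure on the line gives mass `1 - α` to the points at which its
distribution function exceeds `α`. -/
lemma measure_lt_cdf_of_nullSingletonClass (μ : Measure ℝ) [IsProbabilityMeasure μ]
    [NullSingletonClass μ]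
    {α : ℝ} (hα : α ∈ Set.Ioo (0 : ℝ) 1) :
    μ {x | α < cdf μ x} = ENNReal.ofReal (1 - α) := by
  have hcont := continuous_cdf_of_nullSingletonClass μ
  set S : Set ℝ := {x | cdf μ x ≤ α}
  have hclosed : IsClosed S := isClosed_le hcont continuous_const
  have hne : S.Nonempty :=
    (((tendsto_cdf_atBot μ).eventually (gt_mem_nhds hα.1)).exists).imp fun _ h => h.le
  have hbdd : BddAbove S := by
    obtain ⟨b, hb⟩ := ((tendsto_cdf_atTop μ).eventually (lt_mem_nhds hα.2)).exists
    refine ⟨b, fun x hx => le_of_not_gt fun hbx => ?_⟩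
    exact absurd (hb.trans_le (monotone_cdf μ hbx.le)) (not_lt.2 hx)
  have hmem : cdf μ (sSup S) ≤ α := hclosed.csSup_mem hne hbdd
  have hset : {x | α < cdf μ x} = Set.Ioi (sSup S) := by
    ext x
    rw [Set.mem_Ioi, Set.mem_ofPred_eq]
    refine ⟨fun hx => lt_of_not_ge fun hle => ?_, fun hx => ?_⟩
    · exact absurd ((monotone_cdf μ hle).trans hmem) (not_le.2 hx)
    · exact lt_of_not_ge fun h => absurd (le_csSup hbdd h) (not_le.2 hx)
  have heq : cdf μ (sSup S) = α := by
    have hlim : Tendsto (cdf μ) (𝓝[>] sSup S) (𝓝 (cdf μ (sSup S))) :=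
      hcont.continuousAt.mono_left nhdsWithin_le_nhds
    refine le_antisymm hmem (ge_of_tendsto hlim ?_)
    filter_upwards [self_mem_nhdsWithin] with x hx
    exact (hset.ge hx).le
  rw [hset, ← measure_cdf μ, (cdf μ).measure_Ioi (tendsto_cdf_atTop μ), heq]

/-- Corollary 2 (exact coverage): if the law of `T(·,θ)` under `P_θ` has no atoms,
then for every `α ∈ (0,1)` the plausibility region `Pl_y(α) = {θ : pl_y(θ) > α}` has
coverage probability exactly `1 - α`. -/
theorem plausibility_region_exact_coverage
    {Y : Type*} [MeasurableSpace Y] {Θ : Type*}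
    (P : Θ → Measure Y) (hP : ∀ θ, IsProbabilityMeasure (P θ))
    (T : Y → Θ → ℝ) (hT : ∀ θ, Measurable fun y => T y θ)
    (F : Θ → ℝ → ℝ) (hF : ∀ θ t, F θ t = (P θ {y | T y θ ≤ t}).toReal)
    (Pl : Y → ℝ → Set Θ) (hPl : ∀ y a, Pl y a = {θ | a < F θ (T y θ)})
    (θ : Θ) (hnoatom : ∀ t : ℝ, P θ {y | T y θ = t} = 0)
    (α : ℝ) (hα : α ∈ Set.Ioo (0 : ℝ) 1) :
    P θ {y | θ ∈ Pl y α} = ENNReal.ofReal (1 - α) := by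
  have := hP θ
  set μ : Measure ℝ := (P θ).map fun y => T y θ with hμ
  have : IsProbabilityMeasure μ := Measure.isProbabilityMeasure_map (hT θ).aemeasurable
  have : NullSingletonClass μ := ⟨fun t => by
    rw [hμ, Measure.map_apply (hT θ) (measurableSet_singleton t)]
    exact hnoatom t⟩
  have hcdf (t : ℝ) : F θ t = ProbabilityTheory.cdf μ t := by
    rw [hF, ProbabilityTheory.cdf_eq_real, measureReal_def, hμ,
      Measure.map_apply (hT θ) measurableSet_Iic]
    rfl
  rw [← measure_lt_cdf_of_nullSingletonClass μ hα, hμ, Measure.map_apply (hT θ)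
    (measurableSet_lt measurable_const (ProbabilityTheory.monotone_cdf _).measurable)]
  congr 1
  ext y
  simp [hPl, hcdf, hμ]
end
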